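/- arXiv:1307.1545 — 7 statements merged into one kernel-verified Lean document; each statement's English description precedes it below -/
import Mathlib

section
/- Let K be a field of characteristic 0, R an associative K-algebra, λ ∈ K, and P : R → R a K-linear map satisfying the Rota–Baxter identity of weight λ: P(x)P(y) = P(xP(y)) + P(P(x)y) + λP(xy) for all x, y ∈ R. Define a new product on R by x ♥ y = xP(y) + P(x)y + λxy. Then ♥ is an associative product on R, and P satisfies the Rota–Baxter identity of weight λ with respect to ♥, i.e. P(x) ♥ P(y) = P(x ♥ P(y)) + P(P(x) ♥ y) + λP(x ♥ y) for all x, y ∈ R. -/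
/-- The double product `x ♥ y = x P(y) + P(x) y + λ (x y)` associated to a
Rota–Baxter operator `P` of weight `λ`. -/
def heartProd {K R : Type} [Field K] [Ring R] [Algebra K R]
    (lam : K) (P : R →ₗ[K] R) (x y : R) : R :=
  x * P y + P x * y + lam • (x * y)

/-- A Rota–Baxter operator is multiplicative from the double product to the original product. -/
theorem map_heartProd {K R : Type} [Field K] [Ring R] [Algebra K R]
    {lam : K} {P : R →ₗ[K] R}
    (hP : ∀ x y : R, P x * P y = P (x * P y) + P (P x * y) + lam • P (x * y)) (x y : R) :
    P (heartProd lam P x y) = P x * P y := by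
  simp only [heartProd, map_add, map_smul, hP]

/-- If `(R, P)` is a Rota–Baxter algebra of weight `λ` over a field `K`
of characteristic `0`, then the double product `♥` is associative and `P` is again a
Rota–Baxter operator of weight `λ` with respect to `♥`. -/
theorem heartProd_assoc_and_rotaBaxter
    (K R : Type) [Field K] [CharZero K] [Ring R] [Algebra K R]
    (lam : K) (P : R →ₗ[K] R)
    (hP : ∀ x y : R, P x * P y = P (x * P y) + P (P x * y) + lam • P (x * y)) :
    (∀ x y z : R,
        heartProd lam P (heartProd lam P x y) z = heartProd lam P x (heartProd lam P y z)) ∧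
    (∀ x y : R,
        heartProd lam P (P x) (P y) =
          P (heartProd lam P x (P y)) + P (heartProd lam P (P x) y)
            + lam • P (heartProd lam P x y)) := by
  refine ⟨fun x y z => ?_, fun x y => ?_⟩
  · rw [heartProd, heartProd.eq_def lam P x (heartProd lam P y z), map_heartProd hP,
      map_heartProd hP]
    simp only [heartProd, add_mul, mul_add, smul_add, smul_mul_assoc, mul_smul_comm, mul_assoc]
    abel
  · simp only [map_heartProd hP]
    rfl
end

section
/- Let H be a Hopf algebra over a field K of characteristic 0, and let V be a unital associative K-algebra which is a left H-module algebra, i.e. H acts K-linearly on V with h·(vv') = Σ (h₍₁₎·v)(h₍₂₎·v') and h·1_V = ε_H(h)1_V for all h ∈ H and v, v' ∈ V. Equip V ⊗ H with the smash product (v ⊗ h)(v' ⊗ h') = Σ v(h₍₁₎·v') ⊗ h₍₂₎h'. Suppose P : V → V is a K-linear map which is H-linear (P(h·v) = h·P(v)) and is a Rota–Baxter operator of weight 1 on V (P(v)P(v') = P(vP(v')) + P(P(v)v') + P(vv')). Then the map P̃ = P ⊗ id_H is a Rota–Baxter operator of weight 1 on the smash product algebra V ⊗ H: P̃(x)P̃(y)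 = P̃(xP̃(y)) + P̃(P̃(x)y) + P̃(xy) for all x, y ∈ V ⊗ H. -/
open TensorProduct

noncomputable section

variable (K H V : Type) [CommRing K] [Ring H] [HopfAlgebra K H]
  [Ring V] [Algebra K V]

/-- The action, uncurried to a linear map `H ⊗ V → V`. -/
def actLin (act : H →ₗ[K] V →ₗ[K] V) : H ⊗[K] V →ₗ[K] V :=
  TensorProduct.lift act

/-- `h ⊗ (v ⊗ v') ↦ Σ (h₍₁₎ · v)(h₍₂₎ · v')`. -/
def actMulRHS (act : H →ₗ[K] V →ₗ[K] V) : H ⊗[K] (V ⊗[K] V) →ₗ[K] V :=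
  (LinearMap.mul' K V) ∘ₗ
    (TensorProduct.map (actLin K H V act) (actLin K H V act)) ∘ₗ
    (TensorProduct.tensorTensorTensorComm K H H V V).toLinearMap ∘ₗ
    (TensorProduct.map Coalgebra.comul LinearMap.id)

/-- `h ⊗ (v' ⊗ h') ↦ Σ (h₍₁₎ · v') ⊗ h₍₂₎ h'`. -/
def smashInner (act : H →ₗ[K] V →ₗ[K] V) : H ⊗[K] (V ⊗[K] H) →ₗ[K] V ⊗[K] H :=
  (TensorProduct.map (actLin K H V act) (LinearMap.mul' K H)) ∘ₗ
    (TensorProduct.tensorTensorTensorComm K H H V H).toLinearMap ∘ₗ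
    (TensorProduct.map Coalgebra.comul LinearMap.id)

/-- The smash product multiplication on `V ⊗ H`:
`(v ⊗ h)(v' ⊗ h') = Σ v (h₍₁₎ · v') ⊗ h₍₂₎ h'`. -/
def smashMul (act : H →ₗ[K] V →ₗ[K] V) :
    (V ⊗[K] H) ⊗[K] (V ⊗[K] H) →ₗ[K] V ⊗[K] H :=
  (TensorProduct.map (LinearMap.mul' K V) LinearMap.id) ∘ₗ
    (TensorProduct.assoc K V V H).symm.toLinearMap ∘ₗ
    (TensorProduct.map LinearMap.id (smashInner K H V act)) ∘ₗ
    (TensorProduct.assoc K V H (V ⊗[K] H)).toLinearMap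

end

/-- The smash product of pure tensors, along a representation `Δ h = Σ h₍₁₎ ⊗ h₍₂₎`. -/
theorem smashMul_tmul_tmul {K H V : Type} [CommRing K] [Ring H] [HopfAlgebra K H]
    [Ring V] [Algebra K V] (act : H →ₗ[K] V →ₗ[K] V) {h : H} {ι : Type*}
    (r : Coalgebra.Repr K h ι)
    (v v' : V) (h' : H) :
    smashMul K H V act ((v ⊗ₜ[K] h) ⊗ₜ[K] (v' ⊗ₜ[K] h')) =
      ∑ i ∈ r.index, (v * act (r.left i) v') ⊗ₜ[K] (r.right i * h') := by
  simp [smashMul, smashInner, actLin, ← r.eq, sum_tmul, tmul_sum]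

/-- Let `H` be a Hopf algebra over a field `K` of characteristic `0` and
`V` a left `H`-module algebra.  If `P : V → V` is an `H`-linear Rota–Baxter operator of
weight `1`, then `P̃ = P ⊗ id_H` is a Rota–Baxter operator of weight `1` on the smash
product `V ⊗ H`. -/
theorem smash_rotaBaxter (K H V : Type) [Field K] [CharZero K] [Ring H]
    [HopfAlgebra K H] [Ring V] [Algebra K V]
    (act : H →ₗ[K] V →ₗ[K] V)
    -- the action is a left module structure
    (hact_mul : ∀ (h h' : H) (v : V), act (h * h') v = act h (act h' v))
    (hact_one : ∀ v : V, act (1 : H) v = v)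
    -- module algebra axioms
    (hMA : ∀ (h : H) (v v' : V),
      act h (v * v') = actMulRHS K H V act (h ⊗ₜ[K] (v ⊗ₜ[K] v')))
    (hMA1 : ∀ h : H, act h (1 : V) = (Coalgebra.counit (R := K) h) • (1 : V))
    (P : V →ₗ[K] V)
    -- `P` is `H`-linear
    (hPH : ∀ (h : H) (v : V), P (act h v) = act h (P v))
    -- `P` is a Rota-Baxter operator of weight 1 on `V`
    (hRB : ∀ v v' : V, P v * P v' = P (v * P v') + P (P v * v') + P (v * v')) :
    ∀ x y : V ⊗[K] H,
      smashMul K H V act ((TensorProduct.map P LinearMap.id) x ⊗ₜ[K]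
          (TensorProduct.map P LinearMap.id) y) =
        (TensorProduct.map P LinearMap.id)
            (smashMul K H V act (x ⊗ₜ[K] (TensorProduct.map P LinearMap.id) y)) +
          (TensorProduct.map P LinearMap.id)
            (smashMul K H V act ((TensorProduct.map P LinearMap.id) x ⊗ₜ[K] y)) +
          (TensorProduct.map P LinearMap.id)
            (smashMul K H V act (x ⊗ₜ[K] y)) := by
  intro x y
  induction x using TensorProduct.induction_on with
  | zero => simp
  | add x₁ x₂ h₁ h₂ =>
    simp only [map_add, add_tmul, h₁, h₂]
    abel
  | tmul v h =>
    induction y using TensorProduct.induction_on with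
    | zero => simp
    | add y₁ y₂ h₁ h₂ =>
      simp only [map_add, tmul_add, h₁, h₂]
      abel
    | tmul v' h' =>
      simp only [map_tmul, LinearMap.id_coe, id_eq,
        smashMul_tmul_tmul act (Coalgebra.Repr.arbitrary K h), map_sum,
        ← Finset.sum_add_distrib, ← add_tmul, ← hPH, hRB]
end

section
/- Let H be a Hopf algebra over a field K of characteristic 0 with comultiplication Δ and antipode S. Define the K-linear map c : H ⊗ H → H ⊗ H by c(x ⊗ y) = Σ x₍₁₎ y S(x₍₂₎) ⊗ x₍₃₎ (Sweedler notation, with Δ^{(2)}(x) = Σ x₍₁₎⊗x₍₂₎⊗x₍₃₎). Then c satisfies the quantum Yang–Baxter equation: (c ⊗ id_H)(id_H ⊗ c)(c ⊗ id_H) = (id_H ⊗ c)(c ⊗ id_H)(id_H ⊗ c) as linear endomorphisms of H ⊗ H ⊗ H. -/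
open TensorProduct

noncomputable section

variable (K H : Type) [CommRing K] [Ring H] [HopfAlgebra K H]

/-- The linear map `(H ⊗ H) ⊗ H → H`, `(x₁ ⊗ x₂) ⊗ y ↦ x₁ y S(x₂)`. -/
def sandwich : (H ⊗[K] H) ⊗[K] H →ₗ[K] H :=
  (LinearMap.mul' K H) ∘ₗ
    (TensorProduct.map LinearMap.id
      ((LinearMap.mul' K H) ∘ₗ
        (TensorProduct.map LinearMap.id (HopfAlgebra.antipode (R := K))) ∘ₗ
        (TensorProduct.comm K H H).toLinearMap)) ∘ₗ
    (TensorProduct.assoc K H H H).toLinearMap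

/-- The iterated comultiplication `Δ⁽²⁾ = (Δ ⊗ id) ∘ Δ : H → (H ⊗ H) ⊗ H`,
`x ↦ Σ (x₍₁₎ ⊗ x₍₂₎) ⊗ x₍₃₎`. -/
def comul2 : H →ₗ[K] (H ⊗[K] H) ⊗[K] H :=
  (TensorProduct.map Coalgebra.comul LinearMap.id) ∘ₗ Coalgebra.comul

/-- The Yetter–Drinfeld braiding `c : H ⊗ H → H ⊗ H`,
`x ⊗ y ↦ Σ x₍₁₎ y S(x₍₂₎) ⊗ x₍₃₎`. -/
def ydBraiding : H ⊗[K] H →ₗ[K] H ⊗[K] H :=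
  (TensorProduct.map (sandwich K H) LinearMap.id) ∘ₗ
    (TensorProduct.assoc K (H ⊗[K] H) H H).symm.toLinearMap ∘ₗ
    (TensorProduct.map LinearMap.id (TensorProduct.comm K H H).toLinearMap) ∘ₗ
    (TensorProduct.assoc K (H ⊗[K] H) H H).toLinearMap ∘ₗ
    (TensorProduct.map (comul2 K H) LinearMap.id)

/-- `c ⊗ id` on `(H ⊗ H) ⊗ H`. -/
def c₁ : (H ⊗[K] H) ⊗[K] H →ₗ[K] (H ⊗[K] H) ⊗[K] H :=
  TensorProduct.map (ydBraiding K H) LinearMap.id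

/-- `id ⊗ c` on `(H ⊗ H) ⊗ H`. -/
def c₂ : (H ⊗[K] H) ⊗[K] H →ₗ[K] (H ⊗[K] H) ⊗[K] H :=
  (TensorProduct.assoc K H H H).symm.toLinearMap ∘ₗ
    (TensorProduct.map LinearMap.id (ydBraiding K H)) ∘ₗ
    (TensorProduct.assoc K H H H).toLinearMap

end

namespace HopfAlgebra

open Coalgebra WithConv LinearMap

noncomputable section

variable (K : Type*) {H : Type*} [CommRing K] [Ring H] [HopfAlgebra K H]

/-- The adjoint action `x ↦ (y ↦ Σ x₍₁₎ y S(x₍₂₎))` of a Hopf algebra on itself. -/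
def adjoint : H →ₗ[K] Module.End K H :=
  (toConv (LinearMap.mul K H) * toConv ((LinearMap.mul K H).flip ∘ₗ antipode K)).ofConv

theorem adjoint_apply {ι : Type*} {x : H} (r : Repr K x ι) (y : H) :
    adjoint K x y = ∑ i ∈ r.index, r.left i * (y * antipode K (r.right i)) := by
  have h := r.convMul_apply (toConv (LinearMap.mul K H))
    (toConv ((LinearMap.mul K H).flip ∘ₗ antipode K))
  exact congr($h y).trans (by simp)

theorem adjoint_mul (a b z : H) :
    adjoint K (a * b) z = adjoint K a (adjoint K b z) := by
  rw [adjoint_apply K ((ℛ K a).mul (ℛ K b)), adjoint_apply K (ℛ K a), adjoint_apply K (ℛ K b)]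
  simp [antipode_mul_antidistrib, Finset.sum_product, Finset.mul_sum, Finset.sum_mul, mul_assoc]

/-- In the convolution algebra of maps `H → H ⊗ H`, one has
`Σ Δ(S(x₍₁₎)) (x₍₂₎ ⊗ 1) = 1 ⊗ S(x)`. -/
theorem comul_antipode_convMul_inl :
    toConv (comul ∘ₗ antipode K) * toConv ((TensorProduct.mk K H H).flip 1) =
      toConv (TensorProduct.mk K H H 1 ∘ₗ antipode K) := by
  have hinv : toConv (comul ∘ₗ antipode K) * toConv (comul (R := K) (A := H)) = 1 := by
    ext x
    rw [(ℛ K x).convMul_apply]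
    simp [← Bialgebra.comul_mul, ← map_sum, sum_antipode_mul_eq_algebraMap_counit (ℛ K x)]
  have h : toConv (comul (R := K) (A := H)) * toConv (TensorProduct.mk K H H 1 ∘ₗ antipode K) =
      toConv ((TensorProduct.mk K H H).flip 1) := by
    ext x
    rw [(ℛ K x).convMul_apply]
    have hc := coassoc_symm_apply (R := K) x
    have hm := congr((LinearMap.mul' K (H ⊗[K] H) ∘ₗ TensorProduct.map .id
      (TensorProduct.mk K H H 1 ∘ₗ antipode K)) $hc)
    rw [← (ℛ K x).eq] at hm
    simp only [map_sum, LinearMap.lTensor_tmul, LinearMap.rTensor_tmul, LinearMap.comp_apply,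
      TensorProduct.map_tmul, LinearMap.mul'_apply] at hm
    simp only [LinearMap.coe_comp]
    refine hm.symm.trans ?_
    have aux (a : H) (w : H ⊗[K] H) :
        LinearMap.mul' K (H ⊗[K] H) (TensorProduct.map .id (TensorProduct.mk K H H 1 ∘ₗ antipode K)
          ((TensorProduct.assoc K H H H).symm (a ⊗ₜ w))) =
        a ⊗ₜ LinearMap.mul' K H ((antipode K).lTensor H w) := by
      induction w with
      | zero => simp
      | add u v hu hv => simp_all [TensorProduct.tmul_add]
      | tmul u v => simp
    simp only [aux, mul_antipode_lTensor_comul_apply]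
    have hcounit := congr((Algebra.linearMap K H).lTensor H $(sum_tmul_counit_eq (ℛ K x)))
    simpa only [map_sum, LinearMap.lTensor_tmul, Algebra.linearMap_apply, map_one] using! hcounit
  rw [← h, ← mul_assoc, hinv, one_mul]

/-- The diagonal action of `H` on `H ⊗ H`, by left multiplication on the first factor and the
adjoint action on the second. -/
def mulAdjoint : H →ₗ[K] Module.End K (H ⊗[K] H) :=
  TensorProduct.homTensorHomMap (.id _) H H H H ∘ₗ
    TensorProduct.map (LinearMap.mul K H) (adjoint K) ∘ₗ comul

theorem mulAdjoint_apply {ι : Type*} {x : H} (r : Repr K x ι) (w : H ⊗[K] H) :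
    mulAdjoint K x w =
      ∑ i ∈ r.index,
        TensorProduct.map (LinearMap.mulLeft K (r.left i)) (adjoint K (r.right i)) w := by
  rw [mulAdjoint, LinearMap.comp_apply, LinearMap.comp_apply, ← r.eq]
  simp [LinearMap.sum_apply]
  rfl

/-- The Yetter–Drinfeld compatibility of the adjoint action with the comultiplication:
`Σ Δ(x₍₁₎ · y) (x₍₂₎ ⊗ 1) = Σ x₍₁₎ y₍₁₎ ⊗ x₍₂₎ · y₍₂₎`. -/
theorem comul_adjoint_convMul_inl (y : H) :
    toConv (comul ∘ₗ (adjoint K).flip y) * toConv ((TensorProduct.mk K H H).flip 1) =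
      toConv ((mulAdjoint K).flip (comul y)) := by
  have h : toConv (comul ∘ₗ (adjoint K).flip y) =
      toConv (LinearMap.mulRight K (comul y) ∘ₗ comul (R := K) (A := H)) *
        toConv (comul ∘ₗ antipode K) := by
    ext x
    rw [(ℛ K x).convMul_apply]
    simp [adjoint_apply K (ℛ K x), mul_assoc]
  rw [h, mul_assoc, comul_antipode_convMul_inl]
  ext x
  rw [(ℛ K x).convMul_apply]
  have hm := congr((LinearMap.mul' K (H ⊗[K] H) ∘ₗ TensorProduct.map
    (LinearMap.mulRight K (comul y)) (TensorProduct.mk K H H 1 ∘ₗ antipode K))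
    $(coassoc_symm_apply (R := K) x))
  rw [← (ℛ K x).eq] at hm
  simp only [map_sum, LinearMap.lTensor_tmul, LinearMap.rTensor_tmul, LinearMap.comp_apply,
    TensorProduct.map_tmul, LinearMap.mul'_apply] at hm
  simp only [LinearMap.coe_comp]
  refine hm.symm.trans ?_
  simp only [LinearMap.flip_apply, mulAdjoint_apply K (ℛ K x)]
  refine Finset.sum_congr rfl fun i _ ↦ ?_
  rw [← ((ℛ K ((ℛ K x).right i))).eq]
  generalize comul (R := K) y = w
  induction w with
  | zero => simp
  | add u v hu hv =>
    simp_all [TensorProduct.tmul_sum, mul_add, add_mul, Finset.sum_add_distrib]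
  | tmul u v =>
    simp [TensorProduct.tmul_sum, adjoint_apply K (ℛ K ((ℛ K x).right i)), mul_assoc]

end

end HopfAlgebra

section YetterDrinfeld

open Coalgebra HopfAlgebra WithConv

variable (K : Type) {H : Type} [CommRing K] [Ring H] [HopfAlgebra K H]

theorem sandwich_comul_tmul (x y : H) :
    sandwich K H (comul x ⊗ₜ y) = adjoint K x y := by
  rw [adjoint_apply K (ℛ K x), ← (ℛ K x).eq]
  simp [sandwich, TensorProduct.sum_tmul]

theorem ydBraiding_tmul (x y : H) :
    ydBraiding K H (x ⊗ₜ y) = ((adjoint K).flip y).rTensor H (comul x) := by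
  simp only [ydBraiding, comul2, LinearMap.comp_apply, TensorProduct.map_tmul]
  rw [← (ℛ K x).eq]
  simp [TensorProduct.sum_tmul, sandwich_comul_tmul]

theorem c₁_tmul (x y z : H) :
    c₁ K H ((x ⊗ₜ y) ⊗ₜ z) = ((adjoint K).flip y).rTensor H (comul x) ⊗ₜ z := by
  simp [c₁, ydBraiding_tmul]

theorem c₂_tmul (x y z : H) :
    c₂ K H ((x ⊗ₜ y) ⊗ₜ z) =
      (TensorProduct.assoc K H H H).symm (x ⊗ₜ ((adjoint K).flip z).rTensor H (comul y)) := by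
  simp [c₂, ydBraiding_tmul]

theorem ydBraiding_map_adjoint_comul (x y z : H) :
    ydBraiding K H (TensorProduct.map ((adjoint K).flip y) ((adjoint K).flip z) (comul x)) =
      ((adjoint K).flip z).rTensor H (mulAdjoint K x (comul y)) := by
  have h := congr($(comul_adjoint_convMul_inl K y) x)
  rw [(ℛ K x).convMul_apply] at h
  have h' := congr(((adjoint K).flip z).rTensor H $h)
  refine Eq.trans ?_ h'
  rw [← (ℛ K x).eq]
  simp only [map_sum, TensorProduct.map_tmul, ydBraiding_tmul]
  refine Finset.sum_congr rfl fun i _ ↦ ?_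
  simp only [LinearMap.flip_apply, LinearMap.coe_comp, Function.comp_apply,
    TensorProduct.mk_apply]
  generalize comul (R := K) (adjoint K ((ℛ K x).left i) y) = w
  induction w with
  | zero => simp
  | add u v hu hv => simp_all [add_mul]
  | tmul u v => simp [adjoint_mul]

theorem c₁_c₂_c₁_tmul (x y z : H) :
    c₁ K H (c₂ K H (c₁ K H ((x ⊗ₜ y) ⊗ₜ z))) =
      (((adjoint K).flip z).rTensor H ∘ₗ (mulAdjoint K).flip (comul y)).rTensor H (comul x) := by
  have h : c₁ K H (c₂ K H (c₁ K H ((x ⊗ₜ y) ⊗ₜ z))) =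
      (ydBraiding K H ∘ₗ TensorProduct.map ((adjoint K).flip y) ((adjoint K).flip z)).rTensor H
        ((TensorProduct.assoc K H H H).symm (comul.lTensor H (comul x))) := by
    rw [c₁_tmul, ← (ℛ K x).eq]
    simp only [map_sum, LinearMap.rTensor_tmul, LinearMap.lTensor_tmul, TensorProduct.sum_tmul,
      c₂_tmul]
    refine Finset.sum_congr rfl fun i _ ↦ ?_
    rw [← (ℛ K ((ℛ K x).right i)).eq]
    simp [TensorProduct.tmul_sum, c₁]
  rw [h, coassoc_symm_apply, ← (ℛ K x).eq]
  simp [ydBraiding_map_adjoint_comul]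

theorem c₂_c₁_c₂_tmul (x y z : H) :
    c₂ K H (c₁ K H (c₂ K H ((x ⊗ₜ y) ⊗ₜ z))) =
      (((adjoint K).flip z).rTensor H ∘ₗ (mulAdjoint K).flip (comul y)).rTensor H (comul x) := by
  rw [c₂_tmul]
  generalize comul (R := K) y = w
  induction w with
  | zero => simp
  | add u v hu hv =>
    simp only [map_add, TensorProduct.tmul_add, LinearMap.comp_add, LinearMap.rTensor_add,
      LinearMap.add_apply, hu, hv]
  | tmul u v =>
    have h : c₂ K H (c₁ K H ((x ⊗ₜ adjoint K u z) ⊗ₜ v)) =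
        (TensorProduct.map ((adjoint K).flip (adjoint K u z)) ((adjoint K).flip v)).rTensor H
          ((TensorProduct.assoc K H H H).symm (comul.lTensor H (comul x))) := by
      rw [c₁_tmul, ← (ℛ K x).eq]
      simp only [map_sum, LinearMap.rTensor_tmul, LinearMap.lTensor_tmul, TensorProduct.sum_tmul,
        c₂_tmul]
      refine Finset.sum_congr rfl fun i _ ↦ ?_
      rw [← (ℛ K ((ℛ K x).right i)).eq]
      simp [TensorProduct.tmul_sum]
    simp only [LinearMap.rTensor_tmul, LinearMap.flip_apply, TensorProduct.assoc_symm_tmul]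
    rw [h, coassoc_symm_apply, ← (ℛ K x).eq]
    simp only [map_sum, LinearMap.rTensor_tmul]
    refine Finset.sum_congr rfl fun i _ ↦ ?_
    congr 1
    simp only [LinearMap.comp_apply, LinearMap.flip_apply,
      mulAdjoint_apply K (ℛ K ((ℛ K x).left i))]
    rw [← (ℛ K ((ℛ K x).left i)).eq]
    simp [adjoint_mul]

end YetterDrinfeld

/-- For a Hopf algebra `H` over a field `K` of characteristic `0`, the map
`c(x ⊗ y) = Σ x₍₁₎ y S(x₍₂₎) ⊗ x₍₃₎` satisfies the quantum Yang–Baxter equation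
`(c ⊗ id)(id ⊗ c)(c ⊗ id) = (id ⊗ c)(c ⊗ id)(id ⊗ c)` on `H ⊗ H ⊗ H`. -/
theorem ydBraiding_yang_baxter (K H : Type) [Field K] [CharZero K] [Ring H]
    [HopfAlgebra K H] :
    c₁ K H ∘ₗ c₂ K H ∘ₗ c₁ K H = c₂ K H ∘ₗ c₁ K H ∘ₗ c₂ K H := by
  refine TensorProduct.ext_threefold fun x y z ↦ ?_
  simp only [LinearMap.comp_apply, c₁_c₂_c₁_tmul, c₂_c₁_c₂_tmul]
end

section
/- Let K be a field of characteristic 0 and n ≥ 1. Let Cl(n) be the universal Clifford algebra on n generators over K. Then there exists a Hopf algebra structure on Cl(n) over K whose comultiplication Δ and counit η satisfy Δ(ε) = ε ⊗ ε, Δ(v_i) = ε ⊗ v_i + v_i ⊗ 1, Δ(ξ_{ij}) = 1 ⊗ ξ_{ij} + ξ_{ij} ⊗ 1, η(ε) = 1, η(v_i) = 0 and η(ξ_{ij}) = 0 for all 1 ≤ i ≤ j ≤ n (where ε, v_i, ξ_{ij} denote the images of the generators in Cl(n)); moreover the bialgebra structure with these values on the generators is unique. -/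
open TensorProduct

/-- Generators of the universal Clifford algebra: `ε`, `v i`, and `ξ p` for pairs
`p = (i, j)` with `i ≤ j`. -/
inductive ClGen (n : ℕ) : Type
  | eps : ClGen n
  | v : Fin n → ClGen n
  | xi : {p : Fin n × Fin n // p.1 ≤ p.2} → ClGen n

/-- The defining relations of the universal Clifford algebra. -/
inductive ClRel (K : Type) [Field K] (n : ℕ) :
    FreeAlgebra K (ClGen n) → FreeAlgebra K (ClGen n) → Prop
  | eps_sq : ClRel K n (FreeAlgebra.ι K (ClGen.eps) * FreeAlgebra.ι K (ClGen.eps)) 1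
  | eps_xi (p) : ClRel K n
      (FreeAlgebra.ι K (ClGen.eps) * FreeAlgebra.ι K (ClGen.xi p))
      (FreeAlgebra.ι K (ClGen.xi p) * FreeAlgebra.ι K (ClGen.eps))
  | eps_v (i) : ClRel K n
      (FreeAlgebra.ι K (ClGen.eps) * FreeAlgebra.ι K (ClGen.v i) +
        FreeAlgebra.ι K (ClGen.v i) * FreeAlgebra.ι K (ClGen.eps)) 0
  | v_v (i j : Fin n) (h : i ≤ j) : ClRel K n
      (FreeAlgebra.ι K (ClGen.v i) * FreeAlgebra.ι K (ClGen.v j) +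
        FreeAlgebra.ι K (ClGen.v j) * FreeAlgebra.ι K (ClGen.v i))
      (FreeAlgebra.ι K (ClGen.xi ⟨(i, j), h⟩))
  | v_v' (i j : Fin n) (h : j < i) : ClRel K n
      (FreeAlgebra.ι K (ClGen.v i) * FreeAlgebra.ι K (ClGen.v j) +
        FreeAlgebra.ι K (ClGen.v j) * FreeAlgebra.ι K (ClGen.v i))
      (FreeAlgebra.ι K (ClGen.xi ⟨(j, i), le_of_lt h⟩))
  | xi_xi (p q) : ClRel K n
      (FreeAlgebra.ι K (ClGen.xi p) * FreeAlgebra.ι K (ClGen.xi q))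
      (FreeAlgebra.ι K (ClGen.xi q) * FreeAlgebra.ι K (ClGen.xi p))

/-- The universal Clifford algebra `Cl(n)` over `K`. -/
abbrev UnivClifford (K : Type) [Field K] (n : ℕ) : Type := RingQuot (ClRel K n)

variable (K : Type) [Field K] (n : ℕ)

/-- The image of `ε` in `Cl(n)`. -/
noncomputable def epsC : UnivClifford K n :=
  RingQuot.mkAlgHom K (ClRel K n) (FreeAlgebra.ι K ClGen.eps)

/-- The image of `v i` in `Cl(n)`. -/
noncomputable def vC (i : Fin n) : UnivClifford K n :=
  RingQuot.mkAlgHom K (ClRel K n) (FreeAlgebra.ι K (ClGen.v i))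

/-- The image of `ξ p` in `Cl(n)`. -/
noncomputable def xiC (p : {p : Fin n × Fin n // p.1 ≤ p.2}) : UnivClifford K n :=
  RingQuot.mkAlgHom K (ClRel K n) (FreeAlgebra.ι K (ClGen.xi p))

section UnivClifford

variable {K n}

lemma epsC_mul_self : epsC K n * epsC K n = 1 := by
  simpa [epsC, vC, xiC] using RingQuot.mkAlgHom_rel K (ClRel.eps_sq (K := K) (n := n))

lemma epsC_mul_xiC (p) : epsC K n * xiC K n p = xiC K n p * epsC K n := by
  simpa [epsC, vC, xiC] using RingQuot.mkAlgHom_rel K (ClRel.eps_xi (K := K) (n := n) p)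

lemma xiC_mul_xiC (p q) : xiC K n p * xiC K n q = xiC K n q * xiC K n p := by
  simpa [epsC, vC, xiC] using RingQuot.mkAlgHom_rel K (ClRel.xi_xi (K := K) (n := n) p q)

lemma vC_mul_epsC (i) : vC K n i * epsC K n = (-1 : K) • (epsC K n * vC K n i) := by
  have h : epsC K n * vC K n i + vC K n i * epsC K n = 0 := by
    simpa [epsC, vC] using RingQuot.mkAlgHom_rel K (ClRel.eps_v (K := K) (n := n) i)
  calc vC K n i * epsC K n = (-1 : K) • (epsC K n * vC K n i) +
        (epsC K n * vC K n i + vC K n i * epsC K n) := by module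
    _ = (-1 : K) • (epsC K n * vC K n i) := by rw [h, add_zero]

lemma vC_mul_vC_add (i j : Fin n) (h : i ≤ j) :
    vC K n i * vC K n j + vC K n j * vC K n i = xiC K n ⟨(i, j), h⟩ := by
  simpa [epsC, vC, xiC] using RingQuot.mkAlgHom_rel K (ClRel.v_v (K := K) (n := n) i j h)

namespace UnivClifford

/-- To define an algebra map out of `Cl(n)`, it suffices to give images of the generators
satisfying the defining relations. -/
lemma exists_algHom {B : Type*} [Semiring B] [Algebra K B] (e : B) (w : Fin n → B)
    (x : {p : Fin n × Fin n // p.1 ≤ p.2} → B) (he : e * e = 1)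
    (hex : ∀ p, e * x p = x p * e) (hew : ∀ i, e * w i + w i * e = 0)
    (hw : ∀ i j (h : i ≤ j), w i * w j + w j * w i = x ⟨(i, j), h⟩)
    (hx : ∀ p q, x p * x q = x q * x p) :
    ∃ f : UnivClifford K n →ₐ[K] B, f (epsC K n) = e ∧ (∀ i, f (vC K n i) = w i) ∧
      ∀ p, f (xiC K n p) = x p := by
  let g : ClGen n → B := fun c => match c with
    | .eps => e
    | .v i => w i
    | .xi p => x p
  have hg : ∀ ⦃a b⦄, ClRel K n a b → FreeAlgebra.lift K g a = FreeAlgebra.lift K g b := by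
    rintro _ _ (_ | p | i | ⟨i, j, h⟩ | ⟨i, j, h⟩ | ⟨p, q⟩) <;>
      simp only [map_add, map_mul, map_one, map_zero, FreeAlgebra.lift_ι_apply, g]
    · exact he
    · exact hex p
    · exact hew i
    · exact hw i j h
    · rw [add_comm]
      exact hw j i h.le
    · exact hx p q
  refine ⟨RingQuot.liftAlgHom K ⟨FreeAlgebra.lift K g, hg⟩, ?_, fun i => ?_, fun p => ?_⟩ <;>
    simp [epsC, vC, xiC, g]

@[elab_as_elim]
lemma induction {C : UnivClifford K n → Prop}
    (algebraMap : ∀ r, C (algebraMap K _ r)) (eps : C (epsC K n)) (v : ∀ i, C (vC K n i))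
    (xi : ∀ p, C (xiC K n p)) (mul : ∀ a b, C a → C b → C (a * b))
    (add : ∀ a b, C a → C b → C (a + b)) (a : UnivClifford K n) : C a := by
  obtain ⟨a, rfl⟩ := RingQuot.mkAlgHom_surjective K (ClRel K n) a
  induction a using FreeAlgebra.induction with
  | grade0 r => simpa using algebraMap r
  | grade1 c =>
    cases c with
    | eps => exact eps
    | v i => exact v i
    | xi p => exact xi p
  | mul a b ha hb => simpa using mul _ _ ha hb
  | add a b ha hb => simpa using add _ _ ha hb

lemma algHom_ext {B : Type*} [Semiring B] [Algebra K B] {f g : UnivClifford K n →ₐ[K] B}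
    (eps : f (epsC K n) = g (epsC K n)) (v : ∀ i, f (vC K n i) = g (vC K n i))
    (xi : ∀ p, f (xiC K n p) = g (xiC K n p)) : f = g := by
  refine AlgHom.ext fun a => ?_
  induction a using UnivClifford.induction with
  | algebraMap r => simp
  | eps => exact eps
  | v i => exact v i
  | xi p => exact xi p
  | mul a b ha hb => simp only [map_mul, ha, hb]
  | add a b ha hb => simp only [map_add, ha, hb]

variable (K n) in
lemma exists_comul : ∃ Δ : UnivClifford K n →ₐ[K] UnivClifford K n ⊗[K] UnivClifford K n,
    Δ (epsC K n) = epsC K n ⊗ₜ[K] epsC K n ∧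
    (∀ i, Δ (vC K n i) = epsC K n ⊗ₜ[K] vC K n i + vC K n i ⊗ₜ[K] 1) ∧
    ∀ p, Δ (xiC K n p) = 1 ⊗ₜ[K] xiC K n p + xiC K n p ⊗ₜ[K] 1 := by
  apply exists_algHom
  · simp [epsC_mul_self, Algebra.TensorProduct.one_def]
  · intro p
    simp [mul_add, add_mul, epsC_mul_xiC]
  · intro i
    simp only [mul_add, add_mul, Algebra.TensorProduct.tmul_mul_tmul, epsC_mul_self, vC_mul_epsC,
      mul_one, one_mul, tmul_smul, ← smul_tmul']
    module
  · intro i j h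
    simp only [mul_add, add_mul, Algebra.TensorProduct.tmul_mul_tmul, epsC_mul_self, vC_mul_epsC,
      mul_one, one_mul, ← smul_tmul', ← vC_mul_vC_add i j h, tmul_add, add_tmul]
    module
  · intro p q
    simp only [mul_add, add_mul, Algebra.TensorProduct.tmul_mul_tmul, mul_one, one_mul,
      xiC_mul_xiC p q]
    abel

variable (K n) in
lemma exists_counit : ∃ η : UnivClifford K n →ₐ[K] K,
    η (epsC K n) = 1 ∧ (∀ i, η (vC K n i) = 0) ∧ ∀ p, η (xiC K n p) = 0 := by
  apply exists_algHom <;> simp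

variable (K n) in
lemma exists_antipode : ∃ S : UnivClifford K n →ₗ[K] UnivClifford K n,
    S 1 = 1 ∧ (∀ a b, S (a * b) = S b * S a) ∧ S (epsC K n) = epsC K n ∧
    (∀ i, S (vC K n i) = (-1 : K) • (epsC K n * vC K n i)) ∧
    ∀ p, S (xiC K n p) = (-1 : K) • xiC K n p := by
  have key (i j : Fin n) : epsC K n * vC K n i * (epsC K n * vC K n j) =
      (-1 : K) • (vC K n i * vC K n j) := by
    rw [mul_assoc, ← mul_assoc (vC K n i), vC_mul_epsC, smul_mul_assoc, mul_smul_comm, mul_assoc,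
      ← mul_assoc, epsC_mul_self, one_mul]
  obtain ⟨f, he, hv, hx⟩ := exists_algHom (K := K) (n := n) (MulOpposite.op (epsC K n))
    (fun i => MulOpposite.op ((-1 : K) • (epsC K n * vC K n i)))
    (fun p => MulOpposite.op ((-1 : K) • xiC K n p))
    (by rw [← MulOpposite.op_mul, epsC_mul_self, MulOpposite.op_one])
    (fun p => by
      simp only [← MulOpposite.op_mul, smul_mul_assoc, mul_smul_comm, epsC_mul_xiC])
    (fun i => by
      simp only [← MulOpposite.op_mul, ← MulOpposite.op_add, smul_mul_assoc, mul_smul_comm,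
        mul_assoc, vC_mul_epsC]
      rw [← MulOpposite.op_zero]
      congr 1
      module)
    (fun i j h => by
      simp only [← MulOpposite.op_mul, ← MulOpposite.op_add, smul_mul_assoc, mul_smul_comm, key,
        ← vC_mul_vC_add i j h]
      congr 1
      module)
    (fun p q => by
      simp only [← MulOpposite.op_mul, smul_mul_assoc, mul_smul_comm, xiC_mul_xiC p q])
  refine ⟨(MulOpposite.opLinearEquiv K).symm.toLinearMap ∘ₗ f.toLinearMap, ?_, ?_, ?_, ?_, ?_⟩
  · simp
  · simp
  · simp [he]
  · simp [hv, -neg_smul]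
  · simp [hx, -neg_smul]

end UnivClifford

lemma mul'_map_id_mul_tmul {R A : Type*} [CommSemiring R] [Semiring A] [Algebra R A] {S : A →ₗ[R] A}
    (hS : ∀ a b, S (a * b) = S b * S a) (x : A ⊗[R] A) (a b : A) :
    LinearMap.mul' R A (TensorProduct.map S LinearMap.id (x * a ⊗ₜ[R] b)) =
      S a * LinearMap.mul' R A (TensorProduct.map S LinearMap.id x) * b := by
  induction x with
  | zero => simp
  | tmul c d => simp [hS, mul_assoc]
  | add x y hx hy => simp only [add_mul, map_add, hx, hy, mul_add]

lemma mul'_id_map_tmul_mul {R A : Type*} [CommSemiring R] [Semiring A] [Algebra R A] {S : A →ₗ[R] A}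
    (hS : ∀ a b, S (a * b) = S b * S a) (x : A ⊗[R] A) (a b : A) :
    LinearMap.mul' R A (TensorProduct.map LinearMap.id S (a ⊗ₜ[R] b * x)) =
      a * LinearMap.mul' R A (TensorProduct.map LinearMap.id S x) * S b := by
  induction x with
  | zero => simp
  | tmul c d => simp [hS, mul_assoc]
  | add x y hx hy => simp only [add_mul, map_add, hx, hy, mul_add]

lemma mul'_map_id_mul {R A : Type*} [CommSemiring R] [Semiring A] [Algebra R A] {S : A →ₗ[R] A}
    (hS : ∀ a b, S (a * b) = S b * S a) {x y : A ⊗[R] A} {r s : R}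
    (hx : LinearMap.mul' R A (TensorProduct.map S LinearMap.id x) = algebraMap R A r)
    (hy : LinearMap.mul' R A (TensorProduct.map S LinearMap.id y) = algebraMap R A s) :
    LinearMap.mul' R A (TensorProduct.map S LinearMap.id (x * y)) = algebraMap R A (r * s) := by
  rw [(algebraMap R A).map_mul, ← hy]
  clear hy
  induction y with
  | zero => simp
  | tmul c d =>
    rw [mul'_map_id_mul_tmul hS, hx, ← Algebra.commutes, mul_assoc]
    simp
  | add y z hy hz => simp only [mul_add, map_add, hy, hz]

lemma mul'_id_map_mul {R A : Type*} [CommSemiring R] [Semiring A] [Algebra R A] {S : A →ₗ[R] A}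
    (hS : ∀ a b, S (a * b) = S b * S a) {x y : A ⊗[R] A} {r s : R}
    (hx : LinearMap.mul' R A (TensorProduct.map LinearMap.id S x) = algebraMap R A r)
    (hy : LinearMap.mul' R A (TensorProduct.map LinearMap.id S y) = algebraMap R A s) :
    LinearMap.mul' R A (TensorProduct.map LinearMap.id S (x * y)) = algebraMap R A (r * s) := by
  rw [mul_comm, (algebraMap R A).map_mul, ← hx]
  clear hx
  induction x with
  | zero => simp
  | tmul c d =>
    rw [mul'_id_map_tmul_mul hS, hy, ← Algebra.commutes, mul_assoc]
    simp
  | add y z hy hz => simp only [mul_add, add_mul, map_add, hy, hz]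

end UnivClifford

/-- The universal Clifford algebra `Cl(n)` over a field `K` of
characteristic `0` carries a Hopf algebra structure whose comultiplication `Δ` and counit
`η` take the prescribed values on the generators, and the bialgebra structure with these
values on the generators is unique. -/
theorem univClifford_hopf_structure (K : Type) [Field K] [CharZero K]
    (n : ℕ) (hn : 1 ≤ n) :
    ∃ (Δ : UnivClifford K n →ₐ[K] UnivClifford K n ⊗[K] UnivClifford K n)
      (η : UnivClifford K n →ₐ[K] K)
      (S : UnivClifford K n →ₗ[K] UnivClifford K n),
      -- values of `Δ` on the generators
      (Δ (epsC K n) = epsC K n ⊗ₜ[K] epsC K n) ∧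
      (∀ i, Δ (vC K n i) = epsC K n ⊗ₜ[K] vC K n i + vC K n i ⊗ₜ[K] 1) ∧
      (∀ p, Δ (xiC K n p) = 1 ⊗ₜ[K] xiC K n p + xiC K n p ⊗ₜ[K] 1) ∧
      -- values of `η` on the generators
      (η (epsC K n) = 1) ∧ (∀ i, η (vC K n i) = 0) ∧ (∀ p, η (xiC K n p) = 0) ∧
      -- coassociativity
      ((TensorProduct.assoc K (UnivClifford K n) (UnivClifford K n)
            (UnivClifford K n)).toLinearMap ∘ₗ
          (TensorProduct.map Δ.toLinearMap LinearMap.id) ∘ₗ Δ.toLinearMap =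
        (TensorProduct.map LinearMap.id Δ.toLinearMap) ∘ₗ Δ.toLinearMap) ∧
      -- counit axioms
      ((TensorProduct.lid K (UnivClifford K n)).toLinearMap ∘ₗ
          (TensorProduct.map η.toLinearMap LinearMap.id) ∘ₗ Δ.toLinearMap =
        LinearMap.id) ∧
      ((TensorProduct.rid K (UnivClifford K n)).toLinearMap ∘ₗ
          (TensorProduct.map LinearMap.id η.toLinearMap) ∘ₗ Δ.toLinearMap =
        LinearMap.id) ∧
      -- antipode axioms
      ((LinearMap.mul' K (UnivClifford K n)) ∘ₗ
          (TensorProduct.map S LinearMap.id) ∘ₗ Δ.toLinearMap =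
        (Algebra.linearMap K (UnivClifford K n)) ∘ₗ η.toLinearMap) ∧
      ((LinearMap.mul' K (UnivClifford K n)) ∘ₗ
          (TensorProduct.map LinearMap.id S) ∘ₗ Δ.toLinearMap =
        (Algebra.linearMap K (UnivClifford K n)) ∘ₗ η.toLinearMap) ∧
      -- uniqueness of the bialgebra structure with these values on the generators
      (∀ (Δ' : UnivClifford K n →ₐ[K] UnivClifford K n ⊗[K] UnivClifford K n)
         (η' : UnivClifford K n →ₐ[K] K),
        (Δ' (epsC K n) = epsC K n ⊗ₜ[K] epsC K n) →
        (∀ i, Δ' (vC K n i) = epsC K n ⊗ₜ[K] vC K n i + vC K n i ⊗ₜ[K] 1) →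
        (∀ p, Δ' (xiC K n p) = 1 ⊗ₜ[K] xiC K n p + xiC K n p ⊗ₜ[K] 1) →
        (η' (epsC K n) = 1) → (∀ i, η' (vC K n i) = 0) → (∀ p, η' (xiC K n p) = 0) →
        Δ' = Δ ∧ η' = η) := by
  obtain ⟨Δ, Δe, Δv, Δx⟩ := UnivClifford.exists_comul K n
  obtain ⟨η, ηe, ηv, ηx⟩ := UnivClifford.exists_counit K n
  obtain ⟨S, S1, Smul, Se, Sv, Sx⟩ := UnivClifford.exists_antipode K n
  have Sr (r : K) : S (algebraMap K _ r) = algebraMap K _ r := by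
    rw [Algebra.algebraMap_eq_smul_one, map_smul, S1]
  refine ⟨Δ, η, S, Δe, Δv, Δx, ηe, ηv, ηx, ?_, ?_, ?_, ?_, ?_, ?_⟩
  · suffices h : (Algebra.TensorProduct.assoc K K K (UnivClifford K n) (UnivClifford K n)
        (UnivClifford K n)).toAlgHom.comp ((Algebra.TensorProduct.map Δ (.id K _)).comp Δ) =
        (Algebra.TensorProduct.map (.id K _) Δ).comp Δ from congr(($h).toLinearMap)
    apply UnivClifford.algHom_ext <;>
      simp [Δe, Δv, Δx, tmul_add, add_tmul, Algebra.TensorProduct.one_def, add_assoc]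
  · suffices h : (Algebra.TensorProduct.lid K (UnivClifford K n)).toAlgHom.comp
        ((Algebra.TensorProduct.map η (.id K _)).comp Δ) = .id K _ from congr(($h).toLinearMap)
    apply UnivClifford.algHom_ext <;> simp [Δe, Δv, Δx, ηe, ηv, ηx]
  · suffices h : (Algebra.TensorProduct.rid K K (UnivClifford K n)).toAlgHom.comp
        ((Algebra.TensorProduct.map (.id K _) η).comp Δ) = .id K _ from congr(($h).toLinearMap)
    apply UnivClifford.algHom_ext <;> simp [Δe, Δv, Δx, ηe, ηv, ηx]
  · ext1 a
    change LinearMap.mul' K _ (TensorProduct.map S LinearMap.id (Δ a)) = algebraMap K _ (η a)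
    induction a using UnivClifford.induction with
    | algebraMap r => simp [Algebra.TensorProduct.algebraMap_apply, Sr]
    | eps => simp [Δe, ηe, Se, epsC_mul_self]
    | v i =>
      simp only [Δv, ηv, Se, Sv, map_add, map_tmul, LinearMap.id_apply, LinearMap.mul'_apply,
        mul_one, map_zero]
      module
    | xi p =>
      simp only [Δx, ηx, S1, Sx, map_add, map_tmul, LinearMap.id_apply, LinearMap.mul'_apply,
        one_mul, mul_one, map_zero]
      module
    | mul a b ha hb => simpa only [map_mul] using mul'_map_id_mul Smul ha hb
    | add a b ha hb => simp only [map_add, ha, hb]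
  · ext1 a
    change LinearMap.mul' K _ (TensorProduct.map LinearMap.id S (Δ a)) = algebraMap K _ (η a)
    induction a using UnivClifford.induction with
    | algebraMap r => simp [Algebra.TensorProduct.algebraMap_apply, S1]
    | eps => simp [Δe, ηe, Se, epsC_mul_self]
    | v i =>
      simp only [Δv, ηv, Sv, S1, map_add, map_tmul, LinearMap.id_apply, LinearMap.mul'_apply,
        mul_smul_comm, ← mul_assoc, epsC_mul_self, one_mul, mul_one, map_zero]
      module
    | xi p =>
      simp only [Δx, ηx, S1, Sx, map_add, map_tmul, LinearMap.id_apply, LinearMap.mul'_apply,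
        one_mul, mul_one, map_zero]
      module
    | mul a b ha hb => simpa only [map_mul] using mul'_id_map_mul Smul ha hb
    | add a b ha hb => simp only [map_add, ha, hb]
  · intro Δ' η' Δe' Δv' Δx' ηe' ηv' ηx'
    exact ⟨UnivClifford.algHom_ext (by rw [Δe, Δe']) (by simp [Δv, Δv']) (by simp [Δx, Δx']),
      UnivClifford.algHom_ext (by rw [ηe, ηe']) (by simp [ηv, ηv']) (by simp [ηx, ηx'])⟩
end

section
/- Let K be a field of characteristic 0 and n ≥ 1, and let Cl(n) be the universal Clifford algebra on n generators over K. Then the K-algebra homomorphism from the polynomial algebra K[X_{ij} : 1 ≤ i ≤ j ≤ n] to Cl(n) determined by X_{ij} ↦ ξ_{ij} is injective; equivalently, the subalgebra of Cl(n) generated by the elements ξ_{ij} (1 ≤ i ≤ j ≤ n) is a polynomial algebra on these generators. -/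
open TensorProduct

variable (K : Type) [Field K] (n : ℕ)

namespace UnivClifford

/-- The index set of the central generators `ξ`. -/
abbrev Pairs (n : ℕ) : Type := {p : Fin n × Fin n // p.1 ≤ p.2}

/-- The generic symmetric matrix, with entries the variables of a polynomial ring. -/
noncomputable def genericSymm (K : Type) [Field K] (n : ℕ) :
    Matrix (Fin n) (Fin n) (MvPolynomial (Pairs n) K) :=
  Matrix.of fun i j => MvPolynomial.X ⟨(min i j, max i j), min_le_max⟩

/-- The generic quadratic form, whose polar form has the generic symmetric matrix as its
Gram matrix. -/
noncomputable def genericForm (K : Type) [Field K] (n : ℕ) :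
    QuadraticForm (MvPolynomial (Pairs n) K) (Fin n → MvPolynomial (Pairs n) K) :=
  LinearMap.BilinMap.toQuadraticMap
    (Matrix.toBilin' ((MvPolynomial.C 2⁻¹ : MvPolynomial (Pairs n) K) • genericSymm K n))

theorem genericSymm_of_le (K : Type) [Field K] (n : ℕ) {i j : Fin n} (h : i ≤ j) :
    genericSymm K n i j = MvPolynomial.X ⟨(i, j), h⟩ := by
  simp [genericSymm, h]

theorem genericSymm_comm (K : Type) [Field K] (n : ℕ) (i j : Fin n) :
    genericSymm K n i j = genericSymm K n j i := by
  simp [genericSymm, min_comm, max_comm]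

theorem polar_genericForm_single (K : Type) [Field K] [CharZero K] (n : ℕ) (i j : Fin n) :
    QuadraticMap.polar (genericForm K n) (Pi.single i 1) (Pi.single j 1) =
      genericSymm K n i j := by
  rw [genericForm, LinearMap.BilinMap.polar_toQuadraticMap, Matrix.toBilin'_single,
    Matrix.toBilin'_single, Matrix.smul_apply, Matrix.smul_apply, genericSymm_comm K n j i,
    smul_eq_mul, ← add_mul, ← map_add]
  have h : (2⁻¹ : K) + 2⁻¹ = 1 := by norm_num
  rw [h, map_one, one_mul]

/-- The action of the generators of `Cl(n)` on the Clifford algebra of the generic form: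
`ε` acts as the grade involution, `v i` and `ξ p` by left multiplication. -/
noncomputable def genAction (K : Type) [Field K] (n : ℕ) :
    ClGen n → Module.End (MvPolynomial (Pairs n) K) (CliffordAlgebra (genericForm K n))
  | .eps => CliffordAlgebra.involute.toLinearMap
  | .v i => LinearMap.mulLeft _ (CliffordAlgebra.ι (genericForm K n) (Pi.single i 1))
  | .xi p => algebraMap (MvPolynomial (Pairs n) K) _ (MvPolynomial.X p)

theorem genAction_v_add_swap (K : Type) [Field K] [CharZero K] (n : ℕ) (i j : Fin n) :
    genAction K n (.v i) * genAction K n (.v j) + genAction K n (.v j) * genAction K n (.v i) =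
      algebraMap (MvPolynomial (Pairs n) K) _ (genericSymm K n i j) := by
  ext1 x
  simp only [genAction, LinearMap.add_apply, Module.End.mul_apply, LinearMap.mulLeft_apply,
    Module.algebraMap_end_apply, ← mul_assoc, ← add_mul]
  rw [CliffordAlgebra.ι_mul_ι_add_swap, polar_genericForm_single, Algebra.smul_def]

/-- The representation of `Cl(n)` on the Clifford algebra of the generic form. -/
noncomputable def action (K : Type) [Field K] [CharZero K] (n : ℕ) :
    UnivClifford K n →ₐ[K]
      Module.End (MvPolynomial (Pairs n) K) (CliffordAlgebra (genericForm K n)) :=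
  RingQuot.liftAlgHom K ⟨FreeAlgebra.lift K (genAction K n), by
    intro x y h
    induction h with
    | eps_sq =>
      ext1 x
      simp [genAction]
    | eps_xi p =>
      simpa [genAction] using (Algebra.commutes _ _).symm
    | eps_v i =>
      ext1 x
      simp [genAction]
    | v_v i j h =>
      simpa [genAction, genericSymm_of_le K n h] using genAction_v_add_swap K n i j
    | v_v' i j h =>
      simpa [genAction, genericSymm_comm K n i j, genericSymm_of_le K n h.le] using
        genAction_v_add_swap K n i j
    | xi_xi p q =>
      simpa [genAction] using Algebra.commutes _ _⟩

theorem action_xiC (K : Type) [Field K] [CharZero K] (n : ℕ) (p : Pairs n) :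
    action K n (xiC K n p) = algebraMap (MvPolynomial (Pairs n) K) _ (MvPolynomial.X p) := by
  simp [action, xiC, genAction]

theorem algebraMap_cliffordAlgebra_injective {R M : Type*} [CommRing R] [AddCommGroup M]
    [Module R M] [Invertible (2 : R)] (Q : QuadraticForm R M) :
    Function.Injective (algebraMap R (CliffordAlgebra Q)) := by
  intro a b h
  have h' := congrArg (CliffordAlgebra.equivExterior Q) h
  simp only [CliffordAlgebra.equivExterior, CliffordAlgebra.changeFormEquiv_apply,
    CliffordAlgebra.changeForm_algebraMap] at h'
  exact (ExteriorAlgebra.algebraMap_leftInverse M).injective h'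

theorem xiC_commute (K : Type) [Field K] (n : ℕ) (p q : Pairs n) :
    xiC K n p * xiC K n q = xiC K n q * xiC K n p := by
  simpa [xiC] using RingQuot.mkAlgHom_rel K (ClRel.xi_xi (K := K) p q)

open scoped IsMulCommutative in
theorem _root_.MvPolynomial.exists_algHom_of_commute {R σ A : Type*} [CommRing R] [Ring A]
    [Algebra R A] (f : σ → A) (hf : ∀ i j, f i * f j = f j * f i) :
    ∃ φ : MvPolynomial σ R →ₐ[R] A, ∀ i, φ (MvPolynomial.X i) = f i := by
  have : IsMulCommutative (Algebra.adjoin R (Set.range f)) :=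
    Algebra.isMulCommutative_adjoin R (by rintro _ ⟨i, rfl⟩ _ ⟨j, rfl⟩; exact hf i j)
  refine ⟨(Algebra.adjoin R (Set.range f)).val.comp (MvPolynomial.aeval fun i =>
    (⟨f i, Algebra.subset_adjoin ⟨i, rfl⟩⟩ : Algebra.adjoin R (Set.range f))), fun i => ?_⟩
  rw [AlgHom.comp_apply, MvPolynomial.aeval_X]
  rfl

end UnivClifford

/-- The `K`-algebra homomorphism from the polynomial algebra
`K[X_p : p = (i,j), i ≤ j]` to the universal Clifford algebra `Cl(n)` determined by
`X_p ↦ ξ_p` exists (the `ξ_p` commute) and is injective; i.e. the subalgebra generated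
by the `ξ_{ij}` is a polynomial algebra on these generators. -/
theorem univClifford_xi_polynomial (K : Type) [Field K] [CharZero K]
    (n : ℕ) (hn : 1 ≤ n) :
    ∃ φ : MvPolynomial {p : Fin n × Fin n // p.1 ≤ p.2} K →ₐ[K] UnivClifford K n,
      (∀ p, φ (MvPolynomial.X p) = xiC K n p) ∧ Function.Injective φ := by
  obtain ⟨φ, hφ⟩ := MvPolynomial.exists_algHom_of_commute (R := K) _ (UnivClifford.xiC_commute K n)
  refine ⟨φ, hφ, ?_⟩
  have key : (UnivClifford.action K n).comp φ = IsScalarTower.toAlgHom K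
      (MvPolynomial (UnivClifford.Pairs n) K) (Module.End _ _) :=
    MvPolynomial.algHom_ext fun p => by simp [hφ, UnivClifford.action_xiC]
  let : Invertible (2 : MvPolynomial (UnivClifford.Pairs n) K) :=
    (invertibleOfNonzero (two_ne_zero (α := K))).map MvPolynomial.C |>.copy _ (map_ofNat _ 2).symm
  intro a b h
  apply UnivClifford.algebraMap_cliffordAlgebra_injective (UnivClifford.genericForm K n)
  have h' := congrArg (fun x => UnivClifford.action K n x 1) h
  simpa [← AlgHom.comp_apply, key, Algebra.algebraMap_eq_smul_one] using h'
end

section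
/- Let K be a field of characteristic 0, n ≥ 1, V = Kⁿ with standard basis e₁,…,eₙ, and Q a quadratic form on V with polar form B(u,w) = Q(u+w) − Q(u) − Q(w). Let C(n,Q) be the quotient of the free K-algebra on generators ε, v₁,…,vₙ by the two-sided ideal generated by ε² − 1, εv_i + v_iε (1 ≤ i ≤ n), and v_iv_j + v_jv_i − B(e_i,e_j)·1 (1 ≤ i, j ≤ n). Then the K-linear map V → C(n,Q) sending e_i to the class of v_i satisfies x² = Q(x)·1 for every x in its image of V, hence induces a K-algebra homomorphism from the Clifford algebra Cl(V,Q) to C(n,Q), and this homomorphism is injective; i.e., Cl(V,Q) is (isomorphic to) the subalgebra of C(n,Q) generated by the classes of v₁,…,vₙ. -/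
/-- Generators `ε`, `v i`. -/
inductive CGen (n : ℕ) : Type
  | eps : CGen n
  | v : Fin n → CGen n

/-- The defining relations of `C(n, Q)`: `ε² = 1`, `ε v_i = − v_i ε`, and
`v_i v_j + v_j v_i = B(e_i, e_j)·1`, with `B` the polar form of `Q`. -/
inductive CRel (K : Type) [Field K] (n : ℕ) (Q : QuadraticForm K (Fin n → K)) :
    FreeAlgebra K (CGen n) → FreeAlgebra K (CGen n) → Prop
  | eps_sq : CRel K n Q (FreeAlgebra.ι K (CGen.eps) * FreeAlgebra.ι K (CGen.eps)) 1
  | eps_v (i) : CRel K n Q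
      (FreeAlgebra.ι K (CGen.eps) * FreeAlgebra.ι K (CGen.v i) +
        FreeAlgebra.ι K (CGen.v i) * FreeAlgebra.ι K (CGen.eps)) 0
  | v_v (i j : Fin n) : CRel K n Q
      (FreeAlgebra.ι K (CGen.v i) * FreeAlgebra.ι K (CGen.v j) +
        FreeAlgebra.ι K (CGen.v j) * FreeAlgebra.ι K (CGen.v i))
      (algebraMap K (FreeAlgebra K (CGen n))
        (QuadraticMap.polar (⇑Q) (Pi.single i 1) (Pi.single j 1)))

/-- The algebra `C(n, Q)`. -/
abbrev CnQ (K : Type) [Field K] (n : ℕ) (Q : QuadraticForm K (Fin n → K)) : Type :=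
  RingQuot (CRel K n Q)

/-- The class of `v i` in `C(n, Q)`. -/
noncomputable def vCQ (K : Type) [Field K] (n : ℕ) (Q : QuadraticForm K (Fin n → K))
    (i : Fin n) : CnQ K n Q :=
  RingQuot.mkAlgHom K (CRel K n Q) (FreeAlgebra.ι K (CGen.v i))

/-- The linear map `Kⁿ → C(n, Q)` sending `e_i` to the class of `v_i`. -/
noncomputable def linV (K : Type) [Field K] (n : ℕ) (Q : QuadraticForm K (Fin n → K)) :
    (Fin n → K) →ₗ[K] CnQ K n Q :=
  ∑ i : Fin n, (LinearMap.proj i : (Fin n → K) →ₗ[K] K).smulRight (vCQ K n Q i)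

/-- The linear map `Kⁿ → C(n, Q)` sends `e_i` to the class of `v_i`. -/
theorem linV_single (K : Type) [Field K] (n : ℕ) (Q : QuadraticForm K (Fin n → K)) (i : Fin n) :
    linV K n Q (Pi.single i 1) = vCQ K n Q i := by
  simp [linV, Pi.single_apply, ite_smul]

theorem vCQ_mul_add_mul (K : Type) [Field K] (n : ℕ) (Q : QuadraticForm K (Fin n → K))
    (i j : Fin n) :
    vCQ K n Q i * vCQ K n Q j + vCQ K n Q j * vCQ K n Q i =
      algebraMap K (CnQ K n Q) (QuadraticMap.polar Q (Pi.single i 1) (Pi.single j 1)) := by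
  have h := RingQuot.mkAlgHom_rel K (CRel.v_v (K := K) (Q := Q) i j)
  rwa [map_add, map_mul, map_mul, AlgHom.commutes] at h

/-- The Clifford relation, polarized: `xy + yx = B(x, y)·1` on the image of `Kⁿ` in `C(n, Q)`. -/
theorem linV_mul_add_mul (K : Type) [Field K] (n : ℕ) (Q : QuadraticForm K (Fin n → K))
    (x y : Fin n → K) :
    linV K n Q x * linV K n Q y + linV K n Q y * linV K n Q x =
      algebraMap K (CnQ K n Q) (QuadraticMap.polar Q x y) := by
  let M : (Fin n → K) →ₗ[K] (Fin n → K) →ₗ[K] CnQ K n Q :=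
    (LinearMap.mul K (CnQ K n Q)).compl₁₂ (linV K n Q) (linV K n Q)
  have h : M + M.flip = Q.polarBilin.compr₂ (Algebra.linearMap K (CnQ K n Q)) := by
    refine (Pi.basisFun K (Fin n)).ext fun i => (Pi.basisFun K (Fin n)).ext fun j => ?_
    simpa [M, linV_single] using vCQ_mul_add_mul K n Q i j
  simpa [M] using LinearMap.congr_fun₂ h x y

theorem linV_mul_self (K : Type) [Field K] [NeZero (2 : K)] (n : ℕ)
    (Q : QuadraticForm K (Fin n → K)) (x : Fin n → K) :
    linV K n Q x * linV K n Q x = algebraMap K (CnQ K n Q) (Q x) := by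
  have h := linV_mul_add_mul K n Q x x
  rw [QuadraticMap.polar_self, two_nsmul, map_add, ← two_smul K, ← two_smul K] at h
  exact smul_right_injective _ (two_ne_zero (α := K)) h

/-- The representation of `C(n, Q)` on the Clifford algebra in which `v_i` acts by left
multiplication and `ε` by the grade involution. -/
noncomputable def CnQ.toEnd (K : Type) [Field K] (n : ℕ) (Q : QuadraticForm K (Fin n → K)) :
    CnQ K n Q →ₐ[K] Module.End K (CliffordAlgebra Q) :=
  RingQuot.liftAlgHom K ⟨FreeAlgebra.lift K fun
    | CGen.eps => CliffordAlgebra.involute.toLinearMap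
    | CGen.v i => Algebra.lmul K (CliffordAlgebra Q) (CliffordAlgebra.ι Q (Pi.single i 1)), by
      rintro _ _ (_ | i | ⟨i, j⟩)
      · ext a
        simp
      · ext a
        simp
      · simp only [map_add, map_mul, FreeAlgebra.lift_ι_apply, AlgHom.commutes]
        rw [← map_mul (Algebra.lmul K _), ← map_mul (Algebra.lmul K _),
          ← map_add (Algebra.lmul K _), CliffordAlgebra.ι_mul_ι_add_swap,
          AlgHom.commutes]⟩

theorem CnQ.toEnd_vCQ (K : Type) [Field K] (n : ℕ) (Q : QuadraticForm K (Fin n → K))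
    (i : Fin n) :
    CnQ.toEnd K n Q (vCQ K n Q i) =
      Algebra.lmul K (CliffordAlgebra Q) (CliffordAlgebra.ι Q (Pi.single i 1)) := by
  simp [CnQ.toEnd, vCQ]

theorem CnQ.toEnd_linV (K : Type) [Field K] (n : ℕ) (Q : QuadraticForm K (Fin n → K))
    (x : Fin n → K) :
    CnQ.toEnd K n Q (linV K n Q x) =
      Algebra.lmul K (CliffordAlgebra Q) (CliffordAlgebra.ι Q x) := by
  have h : (CnQ.toEnd K n Q).toLinearMap ∘ₗ linV K n Q =
      (Algebra.lmul K (CliffordAlgebra Q)).toLinearMap ∘ₗ CliffordAlgebra.ι Q := by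
    refine (Pi.basisFun K (Fin n)).ext fun i => ?_
    simpa [linV_single] using CnQ.toEnd_vCQ K n Q i
  exact LinearMap.congr_fun h x

/-- The linear map `Kⁿ → C(n,Q)`, `e_i ↦ v_i`, satisfies
`x² = Q(x)·1`, hence induces a `K`-algebra homomorphism `Cl(V,Q) → C(n,Q)`, and this
homomorphism is injective. -/
theorem cliffordAlgebra_into_CnQ (K : Type) [Field K] [CharZero K]
    (n : ℕ) (hn : 1 ≤ n) (Q : QuadraticForm K (Fin n → K)) :
    (∀ x : Fin n → K,
        linV K n Q x * linV K n Q x = algebraMap K (CnQ K n Q) (Q x)) ∧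
    ∃ φ : CliffordAlgebra Q →ₐ[K] CnQ K n Q,
      (∀ x : Fin n → K, φ (CliffordAlgebra.ι Q x) = linV K n Q x) ∧
      Function.Injective φ := by
  refine ⟨linV_mul_self K n Q, CliffordAlgebra.lift Q ⟨linV K n Q, linV_mul_self K n Q⟩,
    CliffordAlgebra.lift_ι_apply _ _, ?_⟩
  have h : (CnQ.toEnd K n Q).comp (CliffordAlgebra.lift Q ⟨linV K n Q, linV_mul_self K n Q⟩) =
      Algebra.lmul K (CliffordAlgebra Q) := by
    ext1
    refine LinearMap.ext fun x => ?_
    simpa using CnQ.toEnd_linV K n Q x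
  refine Function.Injective.of_comp (f := CnQ.toEnd K n Q) ?_
  rw [← AlgHom.coe_comp, h]
  exact Algebra.lmul_injective
end

section
/- Let K be a field of characteristic 0, n ≥ 1, and let Cl(n) be the universal Clifford algebra on n generators over K, endowed with the bialgebra structure determined on generators by Δ(ε) = ε ⊗ ε, Δ(v_i) = ε ⊗ v_i + v_i ⊗ 1, Δ(ξ_{ij}) = 1 ⊗ ξ_{ij} + ξ_{ij} ⊗ 1, η(ε) = 1, η(v_i) = 0, η(ξ_{ij}) = 0. Let q_{ij} ∈ K for 1 ≤ i ≤ j ≤ n, and let I be the two-sided ideal of Cl(n) generated by the elements ξ_{ij} − q_{ij}·1. Then I is a Hopf ideal (i.e., Δ(I) ⊆ I ⊗ Cl(n) + Cl(n) ⊗ I, η(I) = 0, and S(I) ⊆ I) if and only if q_{ij} = 0 for all 1 ≤ i ≤ j ≤ n. -/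
open TensorProduct

variable (K : Type) [Field K] (n : ℕ)

section HopfAlgebra

variable {R A : Type*} [CommRing R] [Ring A] [Algebra R A]

/-- The Hopf algebra structure given by unbundled structure maps satisfying the Hopf axioms. -/
abbrev hopfAlgebraOfMaps (Δ : A →ₐ[R] A ⊗[R] A) (η : A →ₐ[R] R) (S : A →ₗ[R] A)
    (coassoc : (TensorProduct.assoc R A A A).toLinearMap ∘ₗ
      (TensorProduct.map Δ.toLinearMap LinearMap.id) ∘ₗ Δ.toLinearMap =
      (TensorProduct.map LinearMap.id Δ.toLinearMap) ∘ₗ Δ.toLinearMap)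
    (counit_left : (TensorProduct.lid R A).toLinearMap ∘ₗ
      (TensorProduct.map η.toLinearMap LinearMap.id) ∘ₗ Δ.toLinearMap = LinearMap.id)
    (counit_right : (TensorProduct.rid R A).toLinearMap ∘ₗ
      (TensorProduct.map LinearMap.id η.toLinearMap) ∘ₗ Δ.toLinearMap = LinearMap.id)
    (antipode_left : (LinearMap.mul' R A) ∘ₗ (TensorProduct.map S LinearMap.id) ∘ₗ
      Δ.toLinearMap = (Algebra.linearMap R A) ∘ₗ η.toLinearMap)
    (antipode_right : (LinearMap.mul' R A) ∘ₗ (TensorProduct.map LinearMap.id S) ∘ₗ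
      Δ.toLinearMap = (Algebra.linearMap R A) ∘ₗ η.toLinearMap) :
    HopfAlgebra R A :=
  letI : Coalgebra R A :=
    { comul := Δ.toLinearMap
      counit := η.toLinearMap
      coassoc := coassoc
      rTensor_counit_comp_comul := by
        ext a
        apply (TensorProduct.lid R A).injective
        simpa [LinearMap.rTensor] using LinearMap.congr_fun counit_left a
      lTensor_counit_comp_comul := by
        ext a
        apply (TensorProduct.rid R A).injective
        simpa [LinearMap.lTensor] using LinearMap.congr_fun counit_right a }
  letI : Bialgebra R A :=
    Bialgebra.mk' R A (map_one η) (map_mul η _ _) (map_one Δ) (map_mul Δ _ _)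
  { antipode := S
    mul_antipode_rTensor_comul := antipode_left
    mul_antipode_lTensor_comul := antipode_right }

/-- The submodule `M ⊗ A + A ⊗ M` of `A ⊗ A`. -/
abbrev tensorSup (M : Submodule R A) : Submodule R (A ⊗[R] A) :=
  LinearMap.range (TensorProduct.map M.subtype (LinearMap.id : A →ₗ[R] A)) ⊔
    LinearMap.range (TensorProduct.map (LinearMap.id : A →ₗ[R] A) M.subtype)

theorem tmul_mem_tensorSup_left {M : Submodule R A} {m : A} (hm : m ∈ M) (a : A) :
    m ⊗ₜ[R] a ∈ tensorSup M :=
  Submodule.mem_sup_left ⟨⟨m, hm⟩ ⊗ₜ a, rfl⟩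

theorem tmul_mem_tensorSup_right {M : Submodule R A} {m : A} (hm : m ∈ M) (a : A) :
    a ⊗ₜ[R] m ∈ tensorSup M :=
  Submodule.mem_sup_right ⟨a ⊗ₜ ⟨m, hm⟩, rfl⟩

/-- A linear endomorphism sending all `m ⊗ a` and `a ⊗ m` into `M ⊗ A + A ⊗ M` preserves it. -/
theorem map_mem_tensorSup {M : Submodule R A} (f : A ⊗[R] A →ₗ[R] A ⊗[R] A)
    (hl : ∀ m ∈ M, ∀ a, f (m ⊗ₜ a) ∈ tensorSup M)
    (hr : ∀ m ∈ M, ∀ a, f (a ⊗ₜ m) ∈ tensorSup M)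
    {x : A ⊗[R] A} (hx : x ∈ tensorSup M) : f x ∈ tensorSup M := by
  suffices h : tensorSup M ≤ (tensorSup M).comap f from h hx
  refine sup_le ?_ ?_ <;> rintro _ ⟨y, rfl⟩ <;> rw [Submodule.mem_comap]
  · induction y with
    | zero => simp
    | tmul m a => exact hl m m.2 a
    | add y z hy hz => rw [map_add, map_add]; exact add_mem hy hz
  · induction y with
    | zero => simp
    | tmul a m => exact hr m m.2 a
    | add y z hy hz => rw [map_add, map_add]; exact add_mem hy hz

theorem mul_mem_tensorSup_left {M : Submodule R A} (hM : ∀ a, ∀ m ∈ M, a * m ∈ M)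
    (x : A ⊗[R] A) {y : A ⊗[R] A} (hy : y ∈ tensorSup M) : x * y ∈ tensorSup M := by
  induction x with
  | zero => simp
  | tmul a b =>
    refine map_mem_tensorSup (LinearMap.mulLeft R (a ⊗ₜ[R] b)) ?_ ?_ hy <;> intro m hm c
    · simpa using tmul_mem_tensorSup_left (hM a m hm) (b * c)
    · simpa using tmul_mem_tensorSup_right (hM b m hm) (a * c)
  | add x₁ x₂ h₁ h₂ => rw [add_mul]; exact add_mem h₁ h₂

theorem mul_mem_tensorSup_right {M : Submodule R A} (hM : ∀ a, ∀ m ∈ M, m * a ∈ M)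
    (x : A ⊗[R] A) {y : A ⊗[R] A} (hy : y ∈ tensorSup M) : y * x ∈ tensorSup M := by
  induction x with
  | zero => simp
  | tmul a b =>
    refine map_mem_tensorSup (LinearMap.mulRight R (a ⊗ₜ[R] b)) ?_ ?_ hy <;> intro m hm c
    · simpa using tmul_mem_tensorSup_left (hM a m hm) (c * b)
    · simpa using tmul_mem_tensorSup_right (hM b m hm) (c * a)
  | add x₁ x₂ h₁ h₂ => rw [mul_add]; exact add_mem h₁ h₂

theorem TwoSidedIdeal.mem_submodule_span_coe {I : TwoSidedIdeal A} {x : A} :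
    x ∈ Submodule.span R (I : Set A) ↔ x ∈ I := by
  refine ⟨fun hx => ?_, fun hx => Submodule.subset_span hx⟩
  induction hx using Submodule.span_induction with
  | mem x hx => exact hx
  | zero => exact I.zero_mem
  | add x y _ _ hx hy => exact I.add_mem hx hy
  | smul r x _ hx => rw [Algebra.smul_def]; exact I.mul_mem_left _ _ hx

/-- The two-sided ideal generated by a set of primitive elements is a coideal. -/
theorem TwoSidedIdeal.map_mem_tensorSup_span {s : Set A} (Δ : A →ₐ[R] A ⊗[R] A)
    (hs : ∀ x ∈ s, Δ x = 1 ⊗ₜ[R] x + x ⊗ₜ[R] 1) {x : A} (hx : x ∈ TwoSidedIdeal.span s) :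
    Δ x ∈ tensorSup (Submodule.span R (TwoSidedIdeal.span s : Set A)) := by
  have mul_left (a) (m) (hm : m ∈ Submodule.span R (TwoSidedIdeal.span s : Set A)) :
      a * m ∈ Submodule.span R (TwoSidedIdeal.span s : Set A) :=
    mem_submodule_span_coe.2 (mul_mem_left _ _ _ (mem_submodule_span_coe.1 hm))
  have mul_right (a) (m) (hm : m ∈ Submodule.span R (TwoSidedIdeal.span s : Set A)) :
      m * a ∈ Submodule.span R (TwoSidedIdeal.span s : Set A) :=
    mem_submodule_span_coe.2 (mul_mem_right _ _ _ (mem_submodule_span_coe.1 hm))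
  induction hx using TwoSidedIdeal.span_induction with
  | mem x hx =>
    have hx' := Submodule.subset_span (R := R) (subset_span hx)
    rw [hs x hx]
    exact Submodule.add_mem _ (tmul_mem_tensorSup_right hx' 1) (tmul_mem_tensorSup_left hx' 1)
  | zero => rw [map_zero]; exact Submodule.zero_mem _
  | add x y _ _ hx hy => rw [map_add]; exact Submodule.add_mem _ hx hy
  | neg x _ hx => rw [map_neg]; exact Submodule.neg_mem _ hx
  | left_absorb a x _ hx => rw [map_mul]; exact mul_mem_tensorSup_left mul_left _ hx
  | right_absorb a x _ hx => rw [map_mul]; exact mul_mem_tensorSup_right mul_right _ hx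

/-- The two-sided ideal generated by a set of elements killed by a ring homomorphism is killed. -/
theorem TwoSidedIdeal.map_eq_zero_of_mem_span {B : Type*} [Ring B] {s : Set A} (f : A →+* B)
    (hs : ∀ x ∈ s, f x = 0) {x : A} (hx : x ∈ TwoSidedIdeal.span s) : f x = 0 := by
  induction hx using TwoSidedIdeal.span_induction with
  | mem x hx => exact hs x hx
  | zero => exact map_zero f
  | add x y _ _ hx hy => simp [hx, hy]
  | neg x _ hx => simp [hx]
  | left_absorb a x _ hx => simp [hx]
  | right_absorb a x _ hx => simp [hx]

/-- The antipode of a Hopf algebra negates primitive elements. -/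
theorem HopfAlgebra.antipode_eq_neg_of_comul {R A : Type*} [CommRing R] [Ring A]
    [HopfAlgebra R A] {x : A}
    (hx : Coalgebra.comul x = (1 : A) ⊗ₜ[R] x + x ⊗ₜ[R] 1)
    (hx₀ : Coalgebra.counit (R := R) x = 0) : HopfAlgebra.antipode R x = -x := by
  have h := HopfAlgebra.mul_antipode_rTensor_comul_apply (R := R) x
  rw [hx, hx₀] at h
  simp only [map_add, LinearMap.rTensor_tmul, LinearMap.mul'_apply, antipode_one, one_mul,
    mul_one, map_zero] at h
  exact (neg_eq_of_add_eq_zero_right h).symm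

/-- The two-sided ideal generated by a set of primitive elements is stable under the antipode. -/
theorem HopfAlgebra.antipode_mem_span {R A : Type*} [CommRing R] [Ring A]
    [HopfAlgebra R A] {s : Set A}
    (hs : ∀ x ∈ s, Coalgebra.comul x = (1 : A) ⊗ₜ[R] x + x ⊗ₜ[R] 1)
    (hs₀ : ∀ x ∈ s, Coalgebra.counit (R := R) x = 0) {x : A}
    (hx : x ∈ TwoSidedIdeal.span s) : HopfAlgebra.antipode R x ∈ TwoSidedIdeal.span s := by
  induction hx using TwoSidedIdeal.span_induction with
  | mem x hx =>
    rw [antipode_eq_neg_of_comul (hs x hx) (hs₀ x hx)]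
    exact neg_mem (TwoSidedIdeal.subset_span hx)
  | zero => rw [map_zero]; exact zero_mem _
  | add x y _ _ hx hy => rw [map_add]; exact add_mem hx hy
  | neg x _ hx => rw [map_neg]; exact neg_mem hx
  | left_absorb a x _ hx =>
    rw [antipode_mul_antidistrib]; exact TwoSidedIdeal.mul_mem_right _ _ _ hx
  | right_absorb a x _ hx =>
    rw [antipode_mul_antidistrib]; exact TwoSidedIdeal.mul_mem_left _ _ _ hx

end HopfAlgebra

/-- Let `Cl(n)` carry the bialgebra structure determined on the
generators by `Δ(ε) = ε ⊗ ε`, `Δ(v_i) = ε ⊗ v_i + v_i ⊗ 1`,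
`Δ(ξ_{ij}) = 1 ⊗ ξ_{ij} + ξ_{ij} ⊗ 1`, `η(ε) = 1`, `η(v_i) = 0`, `η(ξ_{ij}) = 0`,
with antipode `S`.  For scalars `q_{ij} ∈ K`, the two-sided ideal `I` generated by the
elements `ξ_{ij} − q_{ij}·1` is a Hopf ideal if and only if all `q_{ij} = 0`. -/
theorem univClifford_hopf_ideal_iff (K : Type) [Field K] [CharZero K]
    (n : ℕ) (hn : 1 ≤ n)
    (Δ : UnivClifford K n →ₐ[K] UnivClifford K n ⊗[K] UnivClifford K n)
    (η : UnivClifford K n →ₐ[K] K)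
    (S : UnivClifford K n →ₗ[K] UnivClifford K n)
    -- values of `Δ` and `η` on the generators
    (hΔeps : Δ (epsC K n) = epsC K n ⊗ₜ[K] epsC K n)
    (hΔv : ∀ i, Δ (vC K n i) = epsC K n ⊗ₜ[K] vC K n i + vC K n i ⊗ₜ[K] 1)
    (hΔxi : ∀ p, Δ (xiC K n p) = 1 ⊗ₜ[K] xiC K n p + xiC K n p ⊗ₜ[K] 1)
    (hηeps : η (epsC K n) = 1) (hηv : ∀ i, η (vC K n i) = 0)
    (hηxi : ∀ p, η (xiC K n p) = 0)
    -- Hopf algebra axioms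
    (hcoassoc : (TensorProduct.assoc K (UnivClifford K n) (UnivClifford K n)
          (UnivClifford K n)).toLinearMap ∘ₗ
        (TensorProduct.map Δ.toLinearMap LinearMap.id) ∘ₗ Δ.toLinearMap =
      (TensorProduct.map LinearMap.id Δ.toLinearMap) ∘ₗ Δ.toLinearMap)
    (hcounitl : (TensorProduct.lid K (UnivClifford K n)).toLinearMap ∘ₗ
        (TensorProduct.map η.toLinearMap LinearMap.id) ∘ₗ Δ.toLinearMap = LinearMap.id)
    (hcounitr : (TensorProduct.rid K (UnivClifford K n)).toLinearMap ∘ₗ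
        (TensorProduct.map LinearMap.id η.toLinearMap) ∘ₗ Δ.toLinearMap = LinearMap.id)
    (hS₁ : (LinearMap.mul' K (UnivClifford K n)) ∘ₗ
        (TensorProduct.map S LinearMap.id) ∘ₗ Δ.toLinearMap =
      (Algebra.linearMap K (UnivClifford K n)) ∘ₗ η.toLinearMap)
    (hS₂ : (LinearMap.mul' K (UnivClifford K n)) ∘ₗ
        (TensorProduct.map LinearMap.id S) ∘ₗ Δ.toLinearMap =
      (Algebra.linearMap K (UnivClifford K n)) ∘ₗ η.toLinearMap)
    -- the scalars and the two-sided ideal they generate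
    (q : {p : Fin n × Fin n // p.1 ≤ p.2} → K) :
    (let I : TwoSidedIdeal (UnivClifford K n) :=
        TwoSidedIdeal.span
          {x | ∃ p, x = xiC K n p - algebraMap K (UnivClifford K n) (q p)}
      let Isub : Submodule K (UnivClifford K n) :=
        Submodule.span K (I : Set (UnivClifford K n))
      let J : Submodule K (UnivClifford K n ⊗[K] UnivClifford K n) :=
        LinearMap.range (TensorProduct.map Isub.subtype LinearMap.id) ⊔
          LinearMap.range (TensorProduct.map LinearMap.id Isub.subtype)
      (∀ x ∈ I, Δ x ∈ J) ∧ (∀ x ∈ I, η x = 0) ∧ (∀ x ∈ I, S x ∈ I)) ↔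
    (∀ p, q p = 0) := by
  constructor
  · rintro ⟨-, hη, -⟩ p
    have h := hη _ (TwoSidedIdeal.subset_span ⟨p, rfl⟩)
    rw [map_sub, hηxi, AlgHom.commutes, zero_sub, neg_eq_zero] at h
    exact h
  · intro hq
    have hgen : ∀ x ∈ {x | ∃ p, x = xiC K n p - algebraMap K (UnivClifford K n) (q p)},
        ∃ p, x = xiC K n p := by
      rintro x ⟨p, rfl⟩
      exact ⟨p, by rw [hq, map_zero, sub_zero]⟩
    have hprim : ∀ x ∈ {x | ∃ p, x = xiC K n p - algebraMap K (UnivClifford K n) (q p)},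
        Δ x = 1 ⊗ₜ[K] x + x ⊗ₜ[K] 1 := by
      intro x hx
      obtain ⟨p, rfl⟩ := hgen x hx
      exact hΔxi p
    have hker : ∀ x ∈ {x | ∃ p, x = xiC K n p - algebraMap K (UnivClifford K n) (q p)},
        η x = 0 := by
      intro x hx
      obtain ⟨p, rfl⟩ := hgen x hx
      exact hηxi p
    refine ⟨fun x hx => TwoSidedIdeal.map_mem_tensorSup_span Δ hprim hx,
      fun x hx => TwoSidedIdeal.map_eq_zero_of_mem_span η.toRingHom hker hx, fun x hx => ?_⟩
    let := hopfAlgebraOfMaps Δ η S hcoassoc hcounitl hcounitr hS₁ hS₂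
    exact HopfAlgebra.antipode_mem_span (R := K) hprim hker hx
end
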